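/- Let k ≥ 1 be an integer and 0 < ε < 1; set ρ = 1 − √(ε/k) and L = √(k/ε)·ln(1/ε). Let h : {−1,1}^n → {−1,1} and U ⊆ [n]. Then | E_{x uniform}| Σ_{S⊆U} ĥ(S)·ρ^{|S|}·χ_S(x) | − E_{x uniform}| Σ_{S⊆U, |S|≤L} ĥ(S)·ρ^{|S|}·χ_S(x) | | ≤ ε. -/

import Mathlib

open Finset

noncomputable section

/-- The real sign of a Boolean bit: `true ↦ 1`, `false ↦ -1`. -/
def sgnB (b : Bool) : ℝ := if b then 1 else -1

/-- The character `χ_S(x) = ∏_{i ∈ S} x_i` on the cube `{±1}^n`. -/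
def chi {n : ℕ} (S : Finset (Fin n)) (x : Fin n → Bool) : ℝ := ∏ i ∈ S, sgnB (x i)

/-- The Fourier coefficient `f̂(S) = 2^{-n} ∑_x f(x) χ_S(x)`. -/
def fhat {n : ℕ} (f : (Fin n → Bool) → ℝ) (S : Finset (Fin n)) : ℝ :=
  (∑ x : Fin n → Bool, f x * chi S x) / 2 ^ n

/-- Expectation over a uniformly random point of the cube. -/
def expect {n : ℕ} (f : (Fin n → Bool) → ℝ) : ℝ := (∑ x : Fin n → Bool, f x) / 2 ^ n

/-- `f_{avg,T}(x) = ∑_{S ⊆ T} f̂(S) χ_S(x)`, the conditional expectation of `f` given `x_T`. -/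
def favg {n : ℕ} (f : (Fin n → Bool) → ℝ) (T : Finset (Fin n)) (x : Fin n → Bool) : ℝ :=
  ∑ S ∈ T.powerset, fhat f S * chi S x

/-- `g` is a junta on `T` if it depends only on the coordinates in `T`. -/
def IsJuntaOn {n : ℕ} (g : (Fin n → Bool) → ℝ) (T : Finset (Fin n)) : Prop :=
  ∀ x y : Fin n → Bool, (∀ i ∈ T, x i = y i) → g x = g y

/-- The restriction `f_{B→z}`, viewed as a function on the whole cube that
ignores the coordinates in `B` (they are fixed to `z`). -/
def restrictF {n : ℕ} (f : (Fin n → Bool) → ℝ) (B : Finset (Fin n)) (z : Fin n → Bool) :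
    (Fin n → Bool) → ℝ :=
  fun x => f (fun i => if i ∈ B then z i else x i)

/-- Expectation over a `δ`-random restriction `(J, z) ∼ R_δ`: `J` contains each
coordinate independently with probability `δ`, and `z` is uniform (only its values
outside `J` matter for the functionals we apply this to). -/
def Erestrict {n : ℕ} (δ : ℝ) (F : Finset (Fin n) → (Fin n → Bool) → ℝ) : ℝ :=
  ∑ J : Finset (Fin n), δ ^ J.card * (1 - δ) ^ (n - J.card) *
    ((∑ z : Fin n → Bool, F J z) / 2 ^ n)

/-- `dist(f,g) = Pr_x[f(x) ≠ g(x)]`. -/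
def distF {n : ℕ} (f g : (Fin n → Bool) → ℝ) : ℝ :=
  expect (fun x => if f x = g x then 0 else 1)

lemma sgnB_mul_self (b : Bool) : sgnB b * sgnB b = 1 := by
  cases b <;> simp [sgnB]

/-- Orthogonality of the characters of the cube. -/
lemma sum_chi_mul_chi {n : ℕ} (S T : Finset (Fin n)) :
    ∑ x : Fin n → Bool, chi S x * chi T x = if S = T then 2 ^ n else 0 := by
  have hprod : ∀ x : Fin n → Bool, chi S x * chi T x =
      ∏ i, (if i ∈ S then sgnB (x i) else 1) * (if i ∈ T then sgnB (x i) else 1) := by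
    intro x
    rw [Finset.prod_mul_distrib]
    simp [chi]
  simp_rw [hprod]
  rw [← Fintype.prod_sum
    (fun (i : Fin n) (b : Bool) => (if i ∈ S then sgnB b else 1) * (if i ∈ T then sgnB b else 1))]
  split_ifs with hST
  · subst hST
    have hfactor : ∀ i : Fin n,
        ∑ b : Bool, (if i ∈ S then sgnB b else 1) * (if i ∈ S then sgnB b else 1) = 2 := by
      intro i
      by_cases hi : i ∈ S <;> simp [hi, sgnB_mul_self]
    rw [Finset.prod_congr rfl fun i _ => hfactor i]
    simp
  · obtain ⟨i, hi⟩ : ∃ i, ¬(i ∈ S ↔ i ∈ T) := by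
      by_contra! hall
      exact hST (Finset.ext hall)
    refine Finset.prod_eq_zero (Finset.mem_univ i) ?_
    by_cases hS : i ∈ S <;> by_cases hT : i ∈ T <;> simp_all [sgnB]

lemma cube_expect_mono {n : ℕ} {f g : (Fin n → Bool) → ℝ} (hfg : ∀ x, f x ≤ g x) :
    expect f ≤ expect g := by
  unfold _root_.expect
  gcongr with x
  exact hfg x

lemma cube_expect_add {n : ℕ} (f g : (Fin n → Bool) → ℝ) :
    expect (fun x => f x + g x) = expect f + expect g := by
  simp [_root_.expect, Finset.sum_add_distrib, add_div]

lemma cube_expect_sub {n : ℕ} (f g : (Fin n → Bool) → ℝ) :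
    expect (fun x => f x - g x) = expect f - expect g := by
  simp [_root_.expect, Finset.sum_sub_distrib, sub_div]

lemma cube_expect_const_mul {n : ℕ} (c : ℝ) (f : (Fin n → Bool) → ℝ) :
    expect (fun x => c * f x) = c * expect f := by
  simp [_root_.expect, ← Finset.mul_sum, mul_div_assoc]

lemma cube_expect_const {n : ℕ} (c : ℝ) : expect (fun _ : Fin n → Bool => c) = c := by
  simp [_root_.expect]

lemma cube_expect_sum {n : ℕ} {ι : Type*} (A : Finset ι) (f : ι → (Fin n → Bool) → ℝ) :
    expect (fun x => ∑ i ∈ A, f i x) = ∑ i ∈ A, expect (f i) := by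
  simp only [_root_.expect]
  rw [Finset.sum_comm, Finset.sum_div]

lemma abs_expect_le {n : ℕ} (f : (Fin n → Bool) → ℝ) :
    |expect f| ≤ expect (fun x => |f x|) := by
  simp only [_root_.expect, abs_div, abs_of_pos (show (0 : ℝ) < 2 ^ n by positivity)]
  gcongr
  exact Finset.abs_sum_le_sum_abs _ _

/-- If the second moment is at most `c ^ 2`, the first absolute moment is at most `c`. -/
lemma expect_abs_le_of_expect_sq_le {n : ℕ} {f : (Fin n → Bool) → ℝ} {c : ℝ} (hc : 0 < c)
    (hf : expect (fun x => f x ^ 2) ≤ c ^ 2) : expect (fun x => |f x|) ≤ c := by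
  have hamgm : expect (fun x => 2 * c * |f x|) ≤ expect (fun x => f x ^ 2 + c ^ 2) :=
    cube_expect_mono fun x => by nlinarith [sq_nonneg (|f x| - c), sq_abs (f x)]
  rw [cube_expect_const_mul, cube_expect_add, cube_expect_const] at hamgm
  nlinarith

/-- Parseval's identity for a function given by its Fourier expansion. -/
lemma expect_sq_sum_chi {n : ℕ} (A : Finset (Finset (Fin n))) (a : Finset (Fin n) → ℝ) :
    expect (fun x => (∑ S ∈ A, a S * chi S x) ^ 2) = ∑ S ∈ A, a S ^ 2 := by
  have horth : ∀ S T : Finset (Fin n),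
      expect (fun x => chi S x * chi T x) = if S = T then 1 else 0 := by
    intro S T
    rw [_root_.expect, sum_chi_mul_chi]
    split_ifs <;> simp
  simp_rw [sq, Finset.sum_mul_sum, mul_mul_mul_comm, cube_expect_sum, cube_expect_const_mul, horth]
  refine Finset.sum_congr rfl fun S hS => ?_
  simp [hS]

/-- Bessel's inequality on the cube. -/
lemma sum_fhat_sq_le {n : ℕ} (f : (Fin n → Bool) → ℝ) (A : Finset (Finset (Fin n))) :
    ∑ S ∈ A, fhat f S ^ 2 ≤ expect (fun x => f x ^ 2) := by
  have hcross : expect (fun x => f x * ∑ S ∈ A, fhat f S * chi S x) = ∑ S ∈ A, fhat f S ^ 2 := by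
    simp_rw [Finset.mul_sum, mul_left_comm (f _), cube_expect_sum, cube_expect_const_mul, sq]
    rfl
  have hnonneg : 0 ≤ expect (fun x => (f x - ∑ S ∈ A, fhat f S * chi S x) ^ 2) :=
    div_nonneg (Finset.sum_nonneg fun x _ => sq_nonneg _) (by positivity)
  simp_rw [sub_sq, mul_assoc] at hnonneg
  rw [cube_expect_add, cube_expect_sub, cube_expect_const_mul, hcross, expect_sq_sum_chi] at hnonneg
  linarith

/-- Beyond level `t⁻¹ ln (1 / ε)`, the noise operator with parameter `1 - t` damps by a factor
at most `ε`. -/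
lemma one_sub_pow_le_of_log_le {t ε : ℝ} {m : ℕ} (ht : t ≤ 1) (hε : 0 < ε)
    (hm : Real.log (1 / ε) ≤ t * m) : (1 - t) ^ m ≤ ε := by
  calc (1 - t) ^ m ≤ Real.exp (-t) ^ m :=
        pow_le_pow_left₀ (by linarith) (Real.one_sub_le_exp_neg t) m
    _ = Real.exp (-(t * m)) := by rw [← Real.exp_nat_mul]; ring_nf
    _ ≤ Real.exp (Real.log ε) := by
        rw [one_div, Real.log_inv] at hm
        exact Real.exp_le_exp.mpr (by linarith)
    _ = ε := Real.exp_log hε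

/-- truncating the noisy Fourier expansion above level
`√(k/ε)·ln(1/ε)` changes the expected absolute value by at most `ε`. -/
theorem noisy_truncation_close (n k : ℕ) (hk : 1 ≤ k) (ε : ℝ) (hε0 : 0 < ε) (hε1 : ε < 1)
    (h : (Fin n → Bool) → ℝ) (hh : ∀ x, h x = 1 ∨ h x = -1) (U : Finset (Fin n)) :
    |expect (fun x =>
        |∑ S ∈ U.powerset, fhat h S * (1 - Real.sqrt (ε / k)) ^ S.card * chi S x|)
      - expect (fun x =>
        |∑ S ∈ U.powerset.filter
              (fun S => (S.card : ℝ) ≤ Real.sqrt (k / ε) * Real.log (1 / ε)),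
            fhat h S * (1 - Real.sqrt (ε / k)) ^ S.card * chi S x|)| ≤ ε := by
  set t := Real.sqrt (ε / k) with ht_def
  have hk0 : (0 : ℝ) < k := by exact_mod_cast hk
  have hk1 : (1 : ℝ) ≤ k := by exact_mod_cast hk
  have ht0 : 0 < t := Real.sqrt_pos.mpr (by positivity)
  have ht1 : t ≤ 1 := Real.sqrt_le_one.mpr ((div_le_one hk0).mpr (by linarith))
  have htL : t * Real.sqrt (k / ε) = 1 := by
    rw [ht_def, ← Real.sqrt_mul (by positivity),
      show ε / k * (k / ε) = 1 by field_simp, Real.sqrt_one]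
  set low : Finset (Fin n) → Prop :=
    fun S => (S.card : ℝ) ≤ Real.sqrt (k / ε) * Real.log (1 / ε)
  rw [← cube_expect_sub]
  refine (abs_expect_le _).trans ?_
  have htail : expect (fun x =>
      |∑ S ∈ U.powerset.filter (fun S => ¬ low S), fhat h S * (1 - t) ^ S.card * chi S x|) ≤ ε := by
    refine expect_abs_le_of_expect_sq_le hε0 ?_
    rw [expect_sq_sum_chi]
    calc ∑ S ∈ U.powerset.filter (fun S => ¬ low S), (fhat h S * (1 - t) ^ S.card) ^ 2
        ≤ ∑ S ∈ U.powerset.filter (fun S => ¬ low S), ε ^ 2 * fhat h S ^ 2 := by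
          refine Finset.sum_le_sum fun S hS => ?_
          have hcard : Real.sqrt (k / ε) * Real.log (1 / ε) < S.card :=
            not_le.mp (Finset.mem_filter.mp hS).2
          have hdamp : (1 - t) ^ S.card ≤ ε := by
            refine one_sub_pow_le_of_log_le ht1 hε0 ?_
            calc Real.log (1 / ε) = t * (Real.sqrt (k / ε) * Real.log (1 / ε)) := by
                  rw [← mul_assoc, htL, one_mul]
              _ ≤ t * S.card := by gcongr
          have hdamp0 : 0 ≤ (1 - t) ^ S.card := pow_nonneg (by linarith) _
          rw [mul_pow, mul_comm]
          gcongr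
      _ = ε ^ 2 * ∑ S ∈ U.powerset.filter (fun S => ¬ low S), fhat h S ^ 2 := by
          rw [Finset.mul_sum]
      _ ≤ ε ^ 2 * 1 := by
          gcongr
          refine (sum_fhat_sq_le h _).trans_eq ?_
          have hsq : ∀ x, h x ^ 2 = 1 := fun x => by rcases hh x with hx | hx <;> simp [hx]
          simp_rw [hsq, cube_expect_const]
      _ = ε ^ 2 := mul_one _
  refine (cube_expect_mono fun x => ?_).trans htail
  refine (abs_abs_sub_abs_le_abs_sub _ _).trans_eq ?_
  rw [← Finset.sum_filter_add_sum_filter_not U.powerset low, add_sub_cancel_left]
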